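/- The canonical Nambu bracket on ℝ³, defined for smooth functions A,B,C : ℝ³ → ℝ by {A,B,C}(z) = Σ_{i,j,k} ε_{ijk} (∂A/∂z_i)(∂B/∂z_j)(∂C/∂z_k), i.e., the determinant of the Jacobian matrix of (A,B,C), satisfies the fundamental identity {{A,B,C},D,E} = {{A,D,E},B,C} + {A,{B,D,E},C} + {A,B,{C,D,E}} for all smooth functions A,B,C,D,E : ℝ³ → ℝ. -/

import Mathlib

/-- Partial derivative of `f` at `z` in the `i`-th coordinate direction of `ℝ^N`. -/
noncomputable def pd {N : ℕ} (f : (Fin N → ℝ) → ℝ) (i : Fin N) (z : Fin N → ℝ) : ℝ :=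
  fderiv ℝ f z (Pi.single i 1)

/-- Tri-linear bracket `{A,B,C}(z) = Σ_{i,j,k} λ_{ijk}(z) ∂_i A ∂_j B ∂_k C` associated to
the tensor field `lam`. -/
noncomputable def nambu {N : ℕ} (lam : Fin N → Fin N → Fin N → (Fin N → ℝ) → ℝ)
    (A B C : (Fin N → ℝ) → ℝ) (z : Fin N → ℝ) : ℝ :=
  ∑ i : Fin N, ∑ j : Fin N, ∑ k : Fin N,
    lam i j k z * pd A i z * pd B j z * pd C k z

/-- Total antisymmetry of a tensor field: it changes sign under transposition of any two
of its three indices. -/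
def TotallyAntisym {N : ℕ} (lam : Fin N → Fin N → Fin N → (Fin N → ℝ) → ℝ) : Prop :=
  ∀ (i j k : Fin N) (z : Fin N → ℝ),
    lam i j k z = - lam j i k z ∧ lam i j k z = - lam i k j z ∧ lam i j k z = - lam k j i z

/-- The pointwise algebraic condition on the Nambu tensor coming from the fundamental
identity. -/
def AlgCond {N : ℕ} (lam : Fin N → Fin N → Fin N → (Fin N → ℝ) → ℝ) : Prop :=
  ∀ (z : Fin N → ℝ) (i j k m n p : Fin N),
    lam n i j z * lam m k p z + lam n j k z * lam m i p z + lam n k i z * lam m j p z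
      + lam m i j z * lam n k p z + lam m j k z * lam n i p z + lam m k i z * lam n j p z = 0

/-- The differential condition on the Nambu tensor coming from the fundamental identity. -/
def DiffCond {N : ℕ} (lam : Fin N → Fin N → Fin N → (Fin N → ℝ) → ℝ) : Prop :=
  ∀ (z : Fin N → ℝ) (j k m n p : Fin N),
    ∑ i : Fin N, lam i j k z * pd (lam m n p) i z
      = ∑ i : Fin N, (lam i n p z * pd (lam m j k) i z + lam i p m z * pd (lam n j k) i z
          + lam i m n z * pd (lam p j k) i z)

/-- The fundamental identity for the tri-linear bracket associated to `lam`, required for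
all smooth observables. -/
def FundId {N : ℕ} (lam : Fin N → Fin N → Fin N → (Fin N → ℝ) → ℝ) : Prop :=
  ∀ A B C D E : (Fin N → ℝ) → ℝ,
    ContDiff ℝ (⊤ : ℕ∞) A → ContDiff ℝ (⊤ : ℕ∞) B → ContDiff ℝ (⊤ : ℕ∞) C → ContDiff ℝ (⊤ : ℕ∞) D → ContDiff ℝ (⊤ : ℕ∞) E →
    ∀ z : Fin N → ℝ,
      nambu lam (nambu lam A B C) D E z
        = nambu lam (nambu lam A D E) B C z + nambu lam A (nambu lam B D E) C z
          + nambu lam A B (nambu lam C D E) z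

/-- Kronecker delta on `Fin N`. -/
def kron {N : ℕ} (a b : Fin N) : ℝ := if a = b then 1 else 0

/-- The totally antisymmetric tensor supported on the index triple `(a,b,c)`, normalized so
that its value at `(a,b,c)` is `1`; it is the Levi-Civita tensor on the indices `(a,b,c)`
and vanishes whenever an index lies outside `{a,b,c}`. -/
noncomputable def tripleTensor {N : ℕ} (a b c : Fin N) (i j k : Fin N) : ℝ :=
  Matrix.det !![kron i a, kron i b, kron i c;
                kron j a, kron j b, kron j c;
                kron k a, kron k b, kron k c]

theorem pd_mul {N : ℕ} {f g : (Fin N → ℝ) → ℝ} {z : Fin N → ℝ}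
    (hf : DifferentiableAt ℝ f z) (hg : DifferentiableAt ℝ g z) (i : Fin N) :
    pd (fun w => f w * g w) i z = f z * pd g i z + g z * pd f i z := by
  simp [pd, fderiv_fun_mul hf hg]

theorem pd_add {N : ℕ} {f g : (Fin N → ℝ) → ℝ} {z : Fin N → ℝ}
    (hf : DifferentiableAt ℝ f z) (hg : DifferentiableAt ℝ g z) (i : Fin N) :
    pd (fun w => f w + g w) i z = pd f i z + pd g i z := by
  simp [pd, fderiv_fun_add hf hg]

theorem pd_sub {N : ℕ} {f g : (Fin N → ℝ) → ℝ} {z : Fin N → ℝ}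
    (hf : DifferentiableAt ℝ f z) (hg : DifferentiableAt ℝ g z) (i : Fin N) :
    pd (fun w => f w - g w) i z = pd f i z - pd g i z := by
  simp [pd, fderiv_fun_sub hf hg]

theorem differentiable_pd {N : ℕ} {f : (Fin N → ℝ) → ℝ} (hf : ContDiff ℝ 2 f) (i : Fin N) :
    Differentiable ℝ (pd f i) := by
  have h : Differentiable ℝ (fderiv ℝ f) :=
    (hf.fderiv_right (m := 1) (by norm_num)).differentiable (by norm_num)
  exact fun z => (h z).clm_apply (differentiableAt_const _)

/-- Symmetry of second partial derivatives. -/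
theorem pd_pd_comm {N : ℕ} {f : (Fin N → ℝ) → ℝ} (hf : ContDiff ℝ 2 f) (i j : Fin N)
    (z : Fin N → ℝ) : pd (pd f i) j z = pd (pd f j) i z := by
  have h : Differentiable ℝ (fderiv ℝ f) :=
    (hf.fderiv_right (m := 1) (by norm_num)).differentiable (by norm_num)
  have key (a b : Fin N) : pd (pd f a) b z
      = fderiv ℝ (fderiv ℝ f) z (Pi.single b 1) (Pi.single a 1) := by
    change fderiv ℝ (fun w => fderiv ℝ f w (Pi.single a 1)) z (Pi.single b 1) = _
    rw [fderiv_clm_apply (h z) (differentiableAt_const _)]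
    simp
  rw [key, key]
  exact (hf.contDiffAt.isSymmSndFDerivAt (by simp)) _ _

theorem nambu_tripleTensor (A B C : (Fin 3 → ℝ) → ℝ) :
    nambu (fun i j k (_ : Fin 3 → ℝ) => tripleTensor (0 : Fin 3) 1 2 i j k) A B C = fun z =>
      pd A 0 z * (pd B 1 z * pd C 2 z - pd B 2 z * pd C 1 z)
        + pd A 1 z * (pd B 2 z * pd C 0 z - pd B 0 z * pd C 2 z)
        + pd A 2 z * (pd B 0 z * pd C 1 z - pd B 1 z * pd C 0 z) := by
  funext z
  simp [nambu, tripleTensor, kron, Fin.sum_univ_three, Matrix.det_fin_three]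
  ring

theorem pd_nambu_tripleTensor {A B C : (Fin 3 → ℝ) → ℝ} (hA : ContDiff ℝ 2 A)
    (hB : ContDiff ℝ 2 B) (hC : ContDiff ℝ 2 C) (l : Fin 3) (z : Fin 3 → ℝ) :
    pd (nambu (fun i j k (_ : Fin 3 → ℝ) => tripleTensor (0 : Fin 3) 1 2 i j k) A B C) l z =
      pd (pd A 0) l z * (pd B 1 z * pd C 2 z - pd B 2 z * pd C 1 z)
        + pd (pd A 1) l z * (pd B 2 z * pd C 0 z - pd B 0 z * pd C 2 z)
        + pd (pd A 2) l z * (pd B 0 z * pd C 1 z - pd B 1 z * pd C 0 z)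
        + pd (pd B 0) l z * (pd A 2 z * pd C 1 z - pd A 1 z * pd C 2 z)
        + pd (pd B 1) l z * (pd A 0 z * pd C 2 z - pd A 2 z * pd C 0 z)
        + pd (pd B 2) l z * (pd A 1 z * pd C 0 z - pd A 0 z * pd C 1 z)
        + pd (pd C 0) l z * (pd A 1 z * pd B 2 z - pd A 2 z * pd B 1 z)
        + pd (pd C 1) l z * (pd A 2 z * pd B 0 z - pd A 0 z * pd B 2 z)
        + pd (pd C 2) l z * (pd A 0 z * pd B 1 z - pd A 1 z * pd B 0 z) := by
  have dA (i : Fin 3) : DifferentiableAt ℝ (fun w => pd A i w) z := differentiable_pd hA i z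
  have dB (i : Fin 3) : DifferentiableAt ℝ (fun w => pd B i w) z := differentiable_pd hB i z
  have dC (i : Fin 3) : DifferentiableAt ℝ (fun w => pd C i w) z := differentiable_pd hC i z
  have dBC (i j : Fin 3) : DifferentiableAt ℝ (fun w => pd B i w * pd C j w) z :=
    (dB i).fun_mul (dC j)
  have dt (i j k : Fin 3) : DifferentiableAt ℝ
      (fun w => pd A k w * (pd B i w * pd C j w - pd B j w * pd C i w)) z :=
    (dA k).fun_mul ((dBC i j).fun_sub (dBC j i))
  have hm (i j : Fin 3) : pd (fun w => pd B i w * pd C j w - pd B j w * pd C i w) l z =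
      (pd B i z * pd (pd C j) l z + pd C j z * pd (pd B i) l z)
        - (pd B j z * pd (pd C i) l z + pd C i z * pd (pd B j) l z) := by
    rw [pd_sub (dBC i j) (dBC j i), pd_mul (dB i) (dC j), pd_mul (dB j) (dC i)]
  rw [nambu_tripleTensor, pd_add ((dt 1 2 0).fun_add (dt 2 0 1)) (dt 0 1 2),
    pd_add (dt 1 2 0) (dt 2 0 1), pd_mul (dA 0) ((dBC 1 2).fun_sub (dBC 2 1)),
    pd_mul (dA 1) ((dBC 2 0).fun_sub (dBC 0 2)), pd_mul (dA 2) ((dBC 0 1).fun_sub (dBC 1 0)),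
    hm, hm, hm]
  ring

/-- the canonical Nambu bracket on `ℝ³`, whose tensor is the
three-dimensional Levi-Civita tensor `ε` (so the bracket is the Jacobian determinant of
`(A,B,C)`), satisfies the fundamental identity for all smooth functions. -/
theorem statement3 :
    FundId (fun i j k (_ : Fin 3 → ℝ) => tripleTensor (0 : Fin 3) 1 2 i j k) := by
  intro A B C D E hA hB hC hD hE z
  have h2 {f : (Fin 3 → ℝ) → ℝ} (hf : ContDiff ℝ (⊤ : ℕ∞) f) : ContDiff ℝ 2 f :=
    contDiff_infty.1 hf 2
  replace hA := h2 hA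
  replace hB := h2 hB
  replace hC := h2 hC
  replace hD := h2 hD
  replace hE := h2 hE
  rw [nambu_tripleTensor (nambu _ A B C), nambu_tripleTensor (nambu _ A D E),
    nambu_tripleTensor A (nambu _ B D E), nambu_tripleTensor A B (nambu _ C D E)]
  simp only [pd_nambu_tripleTensor hA hB hC, pd_nambu_tripleTensor hA hD hE,
    pd_nambu_tripleTensor hB hD hE, pd_nambu_tripleTensor hC hD hE]
  rw [pd_pd_comm hA 1 0, pd_pd_comm hA 2 0, pd_pd_comm hA 2 1,
    pd_pd_comm hB 1 0, pd_pd_comm hB 2 0, pd_pd_comm hB 2 1,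
    pd_pd_comm hC 1 0, pd_pd_comm hC 2 0, pd_pd_comm hC 2 1,
    pd_pd_comm hD 1 0, pd_pd_comm hD 2 0, pd_pd_comm hD 2 1,
    pd_pd_comm hE 1 0, pd_pd_comm hE 2 0, pd_pd_comm hE 2 1]
  ring
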